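/- arXiv:2011.08038 — 3 statements merged into one kernel-verified Lean document; each statement's English description precedes it below -/
import Mathlib

section
/- For density matrices ρ (of size n×n) and σ (of size m×m), the von Neumann entropy is additive under tensor (Kronecker) products: S(ρ ⊗ σ) = S(ρ) + S(σ). -/
open scoped Kronecker ComplexOrder

/-- The von Neumann entropy `S(ρ) = -∑ᵢ λᵢ log λᵢ` of a matrix, computed from the
eigenvalues of a Hermitian matrix (with the convention `0 log 0 = 0`, which is how
`Real.log` behaves at `0`); defined to be `0` on non-Hermitian matrices. -/
noncomputable def vonNeumannEntropy {d : Type*} [Fintype d] [DecidableEq d]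
    (ρ : Matrix d d ℂ) : ℝ :=
  if h : ρ.IsHermitian then -∑ i, h.eigenvalues i * Real.log (h.eigenvalues i) else 0

open Matrix Polynomial in
lemma roots_kron {n m : ℕ} (ρ : Matrix (Fin n) (Fin n) ℂ) (σ : Matrix (Fin m) (Fin m) ℂ)
    (hρ : ρ.IsHermitian) (hσ : σ.IsHermitian) :
    (ρ ⊗ₖ σ).charpoly = ∏ p : Fin n × Fin m,
      (X - C ((hρ.eigenvalues p.1 * hσ.eigenvalues p.2 : ℝ) : ℂ)) := by
  conv_lhs => rw [hρ.spectral_theorem, hσ.spectral_theorem]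
  simp only [Unitary.conjStarAlgAut_apply]
  rw [mul_kronecker_mul, charpoly_mul_comm, ← mul_kronecker_mul]
  simp only [← mul_assoc, Unitary.coe_star_mul_self, one_mul]
  rw [diagonal_kronecker_diagonal, charpoly_diagonal]
  simp

open Matrix Polynomial in
lemma sum_kron {n m : ℕ} (ρ : Matrix (Fin n) (Fin n) ℂ) (σ : Matrix (Fin m) (Fin m) ℂ)
    (hρ : ρ.IsHermitian) (hσ : σ.IsHermitian) (h : (ρ ⊗ₖ σ).IsHermitian) (f : ℝ → ℝ) :
    ∑ p, f (h.eigenvalues p) =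
      ∑ p : Fin n × Fin m, f (hρ.eigenvalues p.1 * hσ.eigenvalues p.2) := by
  have h1 := h.roots_charpoly_eq_eigenvalues
  rw [roots_kron ρ σ hρ hσ, Polynomial.roots_prod _ _
    (Finset.prod_ne_zero_iff.mpr fun _ _ => X_sub_C_ne_zero _)] at h1
  simp only [roots_X_sub_C, Multiset.bind_singleton] at h1
  have h2 := congrArg (fun s => (s.map (fun z : ℂ => f z.re)).sum) h1
  simp only [Multiset.map_map] at h2
  exact h2.symm

/-- For density matrices `ρ` and `σ`, the von Neumann entropy is additive under
Kronecker (tensor) products: `S(ρ ⊗ σ) = S(ρ) + S(σ)`. -/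
theorem vonNeumannEntropy_kronecker {n m : ℕ}
    (ρ : Matrix (Fin n) (Fin n) ℂ) (σ : Matrix (Fin m) (Fin m) ℂ)
    (hρ : ρ.PosSemidef) (hρtr : ρ.trace = 1)
    (hσ : σ.PosSemidef) (hσtr : σ.trace = 1) :
    vonNeumannEntropy (ρ ⊗ₖ σ) = vonNeumannEntropy ρ + vonNeumannEntropy σ := by
  have h1 := hρ.isHermitian.trace_eq_sum_eigenvalues
  have h2 := hσ.isHermitian.trace_eq_sum_eigenvalues
  rw [hρtr] at h1
  rw [hσtr] at h2
  have h1 : ∑ i, hρ.isHermitian.eigenvalues i = 1 := by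
    apply Complex.ofReal_injective
    push_cast
    exact h1.symm
  have h2 : ∑ i, hσ.isHermitian.eigenvalues i = 1 := by
    apply Complex.ofReal_injective
    push_cast
    exact h2.symm
  have h : (ρ ⊗ₖ σ).IsHermitian := (hρ.kronecker hσ).isHermitian
  have h3 := sum_kron ρ σ hρ.isHermitian hσ.isHermitian h Real.negMulLog
  unfold vonNeumannEntropy
  rw [dif_pos h, dif_pos hρ.isHermitian, dif_pos hσ.isHermitian]
  simp only [← Finset.sum_neg_distrib, ← neg_mul]
  change ∑ p, Real.negMulLog (h.eigenvalues p) = ∑ i, Real.negMulLog _ + ∑ i, Real.negMulLog _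
  rw [h3, Fintype.sum_prod_type]
  simp only [Real.negMulLog_mul, Finset.sum_add_distrib, ← Finset.sum_mul, ← Finset.mul_sum, h1, h2,
    one_mul]
end

section
/- Let H₀ = 4J₃ S₁^z S₂^z S₃^z with J₃ > 0 and V = ω_x (S₁^x + S₂^x + S₃^x) with ω_x ≠ 0. Index the degenerate ground eigenbasis of H₀ by g = {|001⟩, |010⟩, |100⟩, |111⟩} (eigenvalue E_g = −J₃/2) and its orthogonal complement by the even-weight basis states |n⟩ (eigenvalue E_n = J₃/2). Then the second-order effective matrix A_{μν} = Σ_{n∉g} ⟨μ|V|n⟩⟨n|V|ν⟩ / (E_g − E_n), μ,ν ∈ g, equals the 4×4 matrix −(ω_x²/J₃)((1/4)·I + (1/2)·𝟙), where 𝟙 is the all-ones matrix; its minimal eigenvalue is −9ω_x²/(4J₃), it is a simple eigenvalue, and the corresponding (normalized) eigenvector is (1/2)(1,1,1,1), i.e., the state (√3/2)|W₀₀₁⟩ + (1/2)|111⟩. -/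
open scoped Kronecker

noncomputable section

/-- The computational basis state `|abc⟩` of three qubits. -/
def ket (a b c : Fin 2) : Fin 2 × Fin 2 × Fin 2 → ℂ :=
  fun x => if x = (a, b, c) then 1 else 0

/-- Single-qubit spin operator `S^z = σ_z / 2`. -/
def Sz : Matrix (Fin 2) (Fin 2) ℂ := (1 / 2 : ℂ) • !![1, 0; 0, -1]

/-- Single-qubit spin operator `S^x = σ_x / 2`. -/
def Sx : Matrix (Fin 2) (Fin 2) ℂ := (1 / 2 : ℂ) • !![0, 1; 1, 0]

/-- The identity matrix on one qubit. -/
def I2 : Matrix (Fin 2) (Fin 2) ℂ := 1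

/-- `S₁^z`, acting on qubit 1. -/
def S1z : Matrix (Fin 2 × Fin 2 × Fin 2) (Fin 2 × Fin 2 × Fin 2) ℂ := Sz ⊗ₖ (I2 ⊗ₖ I2)
/-- `S₂^z`, acting on qubit 2. -/
def S2z : Matrix (Fin 2 × Fin 2 × Fin 2) (Fin 2 × Fin 2 × Fin 2) ℂ := I2 ⊗ₖ (Sz ⊗ₖ I2)
/-- `S₃^z`, acting on qubit 3. -/
def S3z : Matrix (Fin 2 × Fin 2 × Fin 2) (Fin 2 × Fin 2 × Fin 2) ℂ := I2 ⊗ₖ (I2 ⊗ₖ Sz)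
/-- `S₁^x`, acting on qubit 1. -/
def S1x : Matrix (Fin 2 × Fin 2 × Fin 2) (Fin 2 × Fin 2 × Fin 2) ℂ := Sx ⊗ₖ (I2 ⊗ₖ I2)
/-- `S₂^x`, acting on qubit 2. -/
def S2x : Matrix (Fin 2 × Fin 2 × Fin 2) (Fin 2 × Fin 2 × Fin 2) ℂ := I2 ⊗ₖ (Sx ⊗ₖ I2)
/-- `S₃^x`, acting on qubit 3. -/
def S3x : Matrix (Fin 2 × Fin 2 × Fin 2) (Fin 2 × Fin 2 × Fin 2) ℂ := I2 ⊗ₖ (I2 ⊗ₖ Sx)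

/-- The W state `|W₀₀₁⟩ = (|001⟩ + |010⟩ + |100⟩)/√3`. -/
def W001 : Fin 2 × Fin 2 × Fin 2 → ℂ :=
  ((Real.sqrt 3 : ℂ))⁻¹ • (ket 0 0 1 + ket 0 1 0 + ket 1 0 0)

end

noncomputable section

open Matrix

/-- The degenerate ground eigenbasis `g = {|001⟩, |010⟩, |100⟩, |111⟩}` of
`H₀ = 4J₃ S₁^z S₂^z S₃^z` (eigenvalue `E_g = −J₃/2`). -/
def groundBasis : Fin 4 → (Fin 2 × Fin 2 × Fin 2 → ℂ) :=
  ![ket 0 0 1, ket 0 1 0, ket 1 0 0, ket 1 1 1]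

/-- The even-weight basis states `|n⟩` spanning the orthogonal complement of the
ground space (eigenvalue `E_n = J₃/2`). -/
def excitedBasis : Fin 4 → (Fin 2 × Fin 2 × Fin 2 → ℂ) :=
  ![ket 0 0 0, ket 0 1 1, ket 1 0 1, ket 1 1 0]

/-- The second-order effective matrix
`A_{μν} = Σ_{n∉g} ⟨μ|V|n⟩⟨n|V|ν⟩ / (E_g − E_n)` on the degenerate ground space, where
`V = ω_x (S₁^x + S₂^x + S₃^x)`, `E_g = −J₃/2` and `E_n = J₃/2`. -/
def effectiveMatrix (J₃ ωx : ℝ) : Matrix (Fin 4) (Fin 4) ℂ :=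
  Matrix.of fun μ ν => ∑ k : Fin 4,
    (star (groundBasis μ) ⬝ᵥ ((ωx : ℂ) • (S1x + S2x + S3x)).mulVec (excitedBasis k)) *
      (star (excitedBasis k) ⬝ᵥ ((ωx : ℂ) • (S1x + S2x + S3x)).mulVec (groundBasis ν)) /
      (((-J₃ / 2 - J₃ / 2 : ℝ)) : ℂ)

lemma ket_V_ket (a b c a' b' c' : Fin 2) (w : ℂ) :
    star (ket a b c) ⬝ᵥ (w • (S1x + S2x + S3x)).mulVec (ket a' b' c') =
      w * (S1x + S2x + S3x) (a, b, c) (a', b', c') := by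
  simp only [dotProduct, Matrix.mulVec, ket, Pi.star_apply]
  simp [apply_ite]

lemma effectiveMatrix_eq (J₃ ωx : ℝ) (hJ₃ : 0 < J₃) :
    effectiveMatrix J₃ ωx =
      ((-(ωx ^ 2 / J₃) : ℝ) : ℂ) •
        ((1 / 4 : ℂ) • (1 : Matrix (Fin 4) (Fin 4) ℂ) +
          (1 / 2 : ℂ) • Matrix.of (fun _ _ => (1 : ℂ))) := by
  have hJ : (J₃ : ℂ) ≠ 0 := by exact_mod_cast hJ₃.ne'
  have hd : (((-J₃ / 2 - J₃ / 2 : ℝ)) : ℂ) = -(J₃ : ℂ) := by push_cast; ring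
  have h1 : ∀ μ k : Fin 4, (star (groundBasis μ) ⬝ᵥ
      ((ωx : ℂ) • (S1x + S2x + S3x)).mulVec (excitedBasis k)) =
      (ωx : ℂ) * (if μ.val + k.val = 3 then 0 else 1 / 2) := by
    intro μ k
    fin_cases μ <;> fin_cases k <;>
      simp [groundBasis, excitedBasis, ket_V_ket, -smul_add, -Complex.coe_smul] <;>
      simp [S1x, S2x, S3x, Sx, I2, Matrix.one_apply]
  have h2 : ∀ μ k : Fin 4, (star (excitedBasis k) ⬝ᵥ
      ((ωx : ℂ) • (S1x + S2x + S3x)).mulVec (groundBasis μ)) =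
      (ωx : ℂ) * (if μ.val + k.val = 3 then 0 else 1 / 2) := by
    intro μ k
    fin_cases μ <;> fin_cases k <;>
      simp [groundBasis, excitedBasis, ket_V_ket, -smul_add, -Complex.coe_smul] <;>
      simp [S1x, S2x, S3x, Sx, I2, Matrix.one_apply]
  ext μ ν
  simp only [effectiveMatrix, Matrix.of_apply, h1, h2, hd]
  fin_cases μ <;> fin_cases ν <;> simp [Fin.sum_univ_four] <;> field_simp <;> ring

lemma effectiveMatrix_mulVec (J₃ ωx : ℝ) (hJ₃ : 0 < J₃) (v : Fin 4 → ℂ) (i : Fin 4) :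
    (effectiveMatrix J₃ ωx).mulVec v i =
      ((-(ωx ^ 2 / J₃) : ℝ) : ℂ) * (v i / 4 + (v 0 + v 1 + v 2 + v 3) / 2) := by
  rw [effectiveMatrix_eq J₃ ωx hJ₃, Matrix.smul_mulVec, Matrix.add_mulVec, Matrix.smul_mulVec,
    Matrix.smul_mulVec, Matrix.one_mulVec]
  simp [Matrix.mulVec, dotProduct, Fin.sum_univ_four]
  ring_nf
  simp

/-- The second-order effective matrix equals `−(ω_x²/J₃)((1/4)·I + (1/2)·𝟙)` where `𝟙`
is the all-ones matrix; its minimal eigenvalue is `−9ω_x²/(4J₃)`, this eigenvalue is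
simple, and the corresponding normalized eigenvector is `(1/2)(1,1,1,1)`, i.e. the
state `(√3/2)|W₀₀₁⟩ + (1/2)|111⟩`. -/
theorem effectiveMatrix_spec (J₃ ωx : ℝ) (hJ₃ : 0 < J₃) (hωx : ωx ≠ 0) :
    effectiveMatrix J₃ ωx =
      ((-(ωx ^ 2 / J₃) : ℝ) : ℂ) •
        ((1 / 4 : ℂ) • (1 : Matrix (Fin 4) (Fin 4) ℂ) +
          (1 / 2 : ℂ) • Matrix.of (fun _ _ => (1 : ℂ))) ∧
    (effectiveMatrix J₃ ωx).mulVec (fun _ => (1 / 2 : ℂ)) =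
      ((-9 * ωx ^ 2 / (4 * J₃) : ℝ) : ℂ) • (fun _ => (1 / 2 : ℂ)) ∧
    (∀ μ : ℂ, μ ∈ spectrum ℂ (effectiveMatrix J₃ ωx) →
      ∃ r : ℝ, μ = (r : ℂ) ∧ -9 * ωx ^ 2 / (4 * J₃) ≤ r) ∧
    (∀ v : Fin 4 → ℂ,
      (effectiveMatrix J₃ ωx).mulVec v = ((-9 * ωx ^ 2 / (4 * J₃) : ℝ) : ℂ) • v →
      ∃ c : ℂ, v = c • (fun _ => (1 / 2 : ℂ))) ∧
    (∑ μ : Fin 4, (1 / 2 : ℂ) • groundBasis μ) =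
      ((Real.sqrt 3 : ℂ) / 2) • W001 + (1 / 2 : ℂ) • ket 1 1 1 := by
  have key : ((-9 * ωx ^ 2 / (4 * J₃) : ℝ) : ℂ) = ((-(ωx ^ 2 / J₃) : ℝ) : ℂ) * (9 / 4) := by
    push_cast
    have hJ : (J₃ : ℂ) ≠ 0 := by exact_mod_cast hJ₃.ne'
    field_simp
  have ha : ((-(ωx ^ 2 / J₃) : ℝ) : ℂ) ≠ 0 := by
    have : (-(ωx ^ 2 / J₃) : ℝ) ≠ 0 := by
      have := hJ₃.ne'
      simp [hωx, this]
    exact_mod_cast this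
  refine ⟨effectiveMatrix_eq J₃ ωx hJ₃, ?_, ?_, ?_, ?_⟩
  · ext i
    rw [effectiveMatrix_mulVec J₃ ωx hJ₃, key]
    simp only [Pi.smul_apply, smul_eq_mul]
    ring
  · intro μ hμ
    rw [← Matrix.spectrum_toLin', ← Module.End.hasEigenvalue_iff_mem_spectrum] at hμ
    obtain ⟨v, hv⟩ := hμ.exists_hasEigenvector
    have hv1 : ∀ i, ((-(ωx ^ 2 / J₃) : ℝ) : ℂ) * (v i / 4 + (v 0 + v 1 + v 2 + v 3) / 2)
        = μ * v i := by
      intro i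
      rw [← effectiveMatrix_mulVec J₃ ωx hJ₃, ← Matrix.toLin'_apply, hv.apply_eq_smul]
      simp
    by_cases hs : v 0 + v 1 + v 2 + v 3 = 0
    · obtain ⟨i, hi⟩ := Function.ne_iff.mp hv.2
      refine ⟨-(ωx ^ 2 / J₃) / 4, ?_, ?_⟩
      · have h := hv1 i
        rw [hs] at h
        apply mul_right_cancel₀ hi
        rw [← h]
        push_cast
        ring
      · have : 0 ≤ ωx ^ 2 / J₃ := by positivity
        have h2 : -9 * ωx ^ 2 / (4 * J₃) = -(9 / 4) * (ωx ^ 2 / J₃) := by field_simp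
        rw [h2]; linarith
    · refine ⟨-9 * ωx ^ 2 / (4 * J₃), ?_, le_rfl⟩
      rw [key]
      apply mul_right_cancel₀ hs
      linear_combination -(hv1 0) - hv1 1 - hv1 2 - hv1 3
  · intro v hv
    refine ⟨(v 0 + v 1 + v 2 + v 3) / 2, ?_⟩
    ext i
    have h := congrFun hv i
    rw [effectiveMatrix_mulVec J₃ ωx hJ₃, key] at h
    simp only [Pi.smul_apply, smul_eq_mul, mul_assoc] at h ⊢
    have h' := mul_left_cancel₀ ha h
    linear_combination -h' / 2
  · have h3 : (Real.sqrt 3 : ℂ) ≠ 0 := by simp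
    have h4 : ((Real.sqrt 3 : ℂ) / 2) • W001
        = (1 / 2 : ℂ) • (ket 0 0 1 + ket 0 1 0 + ket 1 0 0) := by
      rw [W001, smul_smul]
      congr 1
      field_simp
    rw [h4]
    simp [Fin.sum_univ_four, groundBasis]

end
end

section
/- For any two Hermitian complex d×d matrices A and B there exists a constant C ≥ 0 such that for all τ ∈ [0,1], ‖exp(−i(A+B)τ) − exp(−iAτ/2) · exp(−iBτ) · exp(−iAτ/2)‖ ≤ C τ³; that is, the symmetric (second-order) Trotter decomposition approximates the exact evolution with error of order O(τ³). -/
open scoped Matrix.Norms.L2Operator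

/-- Second-order Taylor expansion on `[0,1]` with cubic remainder. -/
def TrT {M : Type*} [NormedRing M] [NormedAlgebra ℝ M] (f : ℝ → M) (a b c : M) : Prop :=
  (fun t : ℝ => f t - (a + t • b + t ^ 2 • c)) =O[Filter.principal (Set.Icc (0 : ℝ) 1)]
    (fun t : ℝ => t ^ 3)

theorem trT_cont {M : Type*} [NormedRing M] [NormedAlgebra ℝ M] (p : ℝ → M)
    (hp : Continuous p) :
    p =O[Filter.principal (Set.Icc (0 : ℝ) 1)] (fun _ : ℝ => (1 : ℝ)) :=
  hp.continuousOn.isBigO_principal isCompact_Icc (by simp) 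

theorem trT_mul {M : Type*} [NormedRing M] [NormedAlgebra ℝ M] {f g : ℝ → M}
    {a b c a' b' c' : M} (hf : TrT f a b c) (hg : TrT g a' b' c') :
    TrT (fun t => f t * g t) (a * a') (a * b' + b * a') (a * c' + b * b' + c * a') := by
  unfold TrT at *
  have h3 : (fun t : ℝ => t ^ 3) =O[Filter.principal (Set.Icc (0 : ℝ) 1)]
      (fun _ : ℝ => (1 : ℝ)) := trT_cont _ (by fun_prop)
  have hp := trT_cont (fun t : ℝ => a + t • b + t ^ 2 • c) (by fun_prop)
  have hq := trT_cont (fun t : ℝ => a' + t • b' + t ^ 2 • c') (by fun_prop)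
  have hr := trT_cont (fun t : ℝ => b * c' + c * b' + t • (c * c')) (by fun_prop)
  have hgb := (hg.trans h3).add hq
  have h1 := hf.mul hgb
  have h2 := hp.mul hg
  have h4 := (Asymptotics.isBigO_refl (fun t : ℝ => t ^ 3)
    (Filter.principal (Set.Icc (0 : ℝ) 1))).smul hr
  simp only [smul_eq_mul, mul_one, one_mul] at h1 h2 h4
  refine ((h1.add h2).add h4).congr_left fun t => ?_
  simp only [sub_add_cancel]
  generalize f t = F
  generalize g t = G
  simp only [mul_add, add_mul, sub_mul, mul_sub, smul_mul_assoc, mul_smul_comm, smul_add, smul_smul]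
  module

theorem trT_exp {M : Type*} [NormedRing M] [NormedAlgebra ℝ M] [CompleteSpace M] (X : M) :
    TrT (fun t => NormedSpace.exp (t • X)) 1 X ((1 / 2 : ℝ) • (X * X)) := by
  letI : NormedAlgebra ℚ M := NormedAlgebra.restrictScalars ℚ ℝ M
  have hs : Summable fun n : ℕ => ‖((n.factorial : ℝ)⁻¹) • X ^ n‖ :=
    NormedSpace.norm_expSeries_summable' X
  have hs3 := (summable_nat_add_iff 3).2 hs
  refine Asymptotics.IsBigO.of_bound (∑' n : ℕ, ‖(((n + 3).factorial : ℝ)⁻¹) • X ^ (n + 3)‖) ?_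
  rw [Filter.eventually_principal]
  intro t ht
  have hst : Summable fun n : ℕ => ((n.factorial : ℝ)⁻¹) • (t • X) ^ n :=
    NormedSpace.expSeries_summable' (t • X)
  have he : NormedSpace.exp (t • X) = ∑' n : ℕ, ((n.factorial : ℝ)⁻¹) • (t • X) ^ n := by
    rw [NormedSpace.exp_eq_tsum ℝ]
  have h := hst.sum_add_tsum_nat_add 3
  have e : NormedSpace.exp (t • X) - (1 + t • X + t ^ 2 • ((1 / 2 : ℝ) • (X * X)))
      = ∑' n : ℕ, (((n + 3).factorial : ℝ)⁻¹) • (t • X) ^ (n + 3) := by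
    rw [he, ← h]
    simp [Finset.sum_range_succ, Nat.factorial, smul_pow, smul_smul, pow_two, mul_comm]
  rw [e, mul_comm, ← tsum_mul_left]
  have hb : ∀ n : ℕ, ‖(((n + 3).factorial : ℝ)⁻¹) • (t • X) ^ (n + 3)‖ ≤
      ‖t ^ 3‖ * ‖(((n + 3).factorial : ℝ)⁻¹) • X ^ (n + 3)‖ := by
    intro n
    rw [smul_pow, smul_comm, norm_smul]
    gcongr
    rw [pow_add, norm_mul]
    refine mul_le_of_le_one_left (norm_nonneg _) ?_
    rw [norm_pow, Real.norm_of_nonneg ht.1]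
    exact pow_le_one₀ ht.1 ht.2
  exact tsum_of_norm_bounded (hs3.mul_left _).hasSum hb

open NormedSpace in
/-- Symmetric (second-order) Trotter decomposition: for Hermitian `A`, `B` there is a
constant `C ≥ 0` such that for all `τ ∈ [0,1]`,
`‖exp(−i(A+B)τ) − exp(−iAτ/2)·exp(−iBτ)·exp(−iAτ/2)‖ ≤ C τ³`
(in the `ℓ²` operator norm on matrices). -/
theorem trotter_second_order {d : ℕ} (A B : Matrix (Fin d) (Fin d) ℂ)
    (hA : A.IsHermitian) (hB : B.IsHermitian) :
    ∃ C : ℝ, 0 ≤ C ∧ ∀ τ ∈ Set.Icc (0 : ℝ) 1,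
      ‖exp ((-(Complex.I * (τ : ℂ))) • (A + B)) -
          exp ((-(Complex.I * (τ : ℂ) / 2)) • A) *
            exp ((-(Complex.I * (τ : ℂ))) • B) *
            exp ((-(Complex.I * (τ : ℂ) / 2)) • A)‖ ≤ C * τ ^ 3 := by
  obtain ⟨a, ha⟩ : ∃ a, a = (-(Complex.I / 2)) • A := ⟨_, rfl⟩
  obtain ⟨b, hb⟩ : ∃ b, b = (-Complex.I) • B := ⟨_, rfl⟩
  have h1 := trT_mul (trT_mul (trT_exp a) (trT_exp b)) (trT_exp a)
  have h2 := trT_exp (a + b + a)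
  unfold TrT at h1 h2
  obtain ⟨C, hC, h⟩ := (h2.sub h1).exists_nonneg
  rw [Asymptotics.isBigOWith_principal] at h
  refine ⟨C, hC, fun τ hτ => ?_⟩
  have h' := h τ hτ
  rw [Real.norm_of_nonneg (pow_nonneg hτ.1 3)] at h'
  have e1 : (-(Complex.I * (τ : ℂ))) • (A + B) = τ • (a + b + a) := by
    rw [ha, hb, ← Complex.coe_smul]; module
  have e2 : (-(Complex.I * (τ : ℂ) / 2)) • A = τ • a := by
    rw [ha, ← Complex.coe_smul]; module
  have e3 : (-(Complex.I * (τ : ℂ))) • B = τ • b := by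
    rw [hb, ← Complex.coe_smul]; module
  rw [e1, e2, e3]
  refine le_trans (le_of_eq ?_) h'
  congr 1
  beta_reduce
  generalize exp (τ • (a + b + a)) = E
  generalize exp (τ • a) * exp (τ • b) * exp (τ • a) = F
  simp only [mul_add, add_mul, smul_mul_assoc, mul_smul_comm, one_mul, mul_one]
  module
end
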